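/- Let G be the subgroup of GL(4,ℂ) generated by {diag(𝔖, (𝔖⁻¹)†) : 𝔖 ∈ SL(2,ℂ)} together with γ₀ and γ₁γ₂γ₃. If Ŝ ∈ G commutes with all four Dirac matrices, i.e. Ŝ·γ_m = γ_m·Ŝ for m = 0,1,2,3, then Ŝ = 1 or Ŝ = -1 (the plus or minus 4×4 identity matrix). -/

import Mathlib

open Matrix Complex

noncomputable section

/-- The Pauli matrices σ₀, σ₁, σ₂, σ₃. -/
def Pauli : Fin 4 → Matrix (Fin 2) (Fin 2) ℂ :=
  ![!![1, 0; 0, 1], !![0, 1; 1, 0], !![0, -I; I, 0], !![1, 0; 0, -1]]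

/-- The tilde Pauli matrices: σ̃₀ = σ₀ and σ̃ₘ = -σₘ for m = 1,2,3. -/
def PauliT : Fin 4 → Matrix (Fin 2) (Fin 2) ℂ :=
  ![!![1, 0; 0, 1], -!![0, 1; 1, 0], -!![0, -I; I, 0], -!![1, 0; 0, -1]]

/-- The Dirac matrices γₘ = [[0, σₘ],[σ̃ₘ, 0]] in 2×2-block form, written out as 4×4 matrices. -/
def Dirac : Fin 4 → Matrix (Fin 4) (Fin 4) ℂ :=
  ![!![0, 0, 1, 0; 0, 0, 0, 1; 1, 0, 0, 0; 0, 1, 0, 0],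
    !![0, 0, 0, 1; 0, 0, 1, 0; 0, -1, 0, 0; -1, 0, 0, 0],
    !![0, 0, 0, -I; 0, 0, I, 0; 0, I, 0, 0; -I, 0, 0, 0],
    !![0, 0, 1, 0; 0, 0, 0, -1; -1, 0, 0, 0; 0, 1, 0, 0]]

/-- The Minkowski metric matrix g = diag(1,-1,-1,-1). -/
def etaMink : Matrix (Fin 4) (Fin 4) ℝ := !![1,0,0,0; 0,-1,0,0; 0,0,-1,0; 0,0,0,-1]

/-- The defining relation of the homomorphism φ: 𝔖 σₘ 𝔖† = Σₖ Sᵏₘ σₖ. -/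
def IsPhi (𝔖 : Matrix (Fin 2) (Fin 2) ℂ) (S : Matrix (Fin 4) (Fin 4) ℝ) : Prop :=
  ∀ m : Fin 4, 𝔖 * Pauli m * 𝔖ᴴ = ∑ k : Fin 4, (S k m : ℂ) • Pauli k

/-- The block-diagonal matrix Ŝ = diag(𝔖, (𝔖⁻¹)†). -/
def hatM (A : Matrix (Fin 2) (Fin 2) ℂ) : Matrix (Fin 4) (Fin 4) ℂ :=
  !![A 0 0, A 0 1, 0, 0;
     A 1 0, A 1 1, 0, 0;
     0, 0, ((A⁻¹)ᴴ) 0 0, ((A⁻¹)ᴴ) 0 1;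
     0, 0, ((A⁻¹)ᴴ) 1 0, ((A⁻¹)ᴴ) 1 1]

/-- The generating set in GL(4,ℂ): all matrices diag(𝔖,(𝔖⁻¹)†) for 𝔖 ∈ SL(2,ℂ)
together with the two matrices a and b. -/
def genSet (a b : Matrix (Fin 4) (Fin 4) ℂ) :
    Set (Matrix.GeneralLinearGroup (Fin 4) ℂ) :=
  {g | (∃ 𝔖 : Matrix (Fin 2) (Fin 2) ℂ, 𝔖.det = 1 ∧ g.val = hatM 𝔖) ∨
        g.val = a ∨ g.val = b}

/-- The matrix diag(ε, ε) with ε the 2×2 symplectic form. -/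
def chargeForm : Matrix (Fin 4) (Fin 4) ℂ :=
  !![0, 1, 0, 0; -1, 0, 0, 0; 0, 0, 0, 1; 0, 0, -1, 0]

/-- `M` scales the Hermitian form `γ₀` and the bilinear form `chargeForm` by the same factor. -/
def ScalesForms (s : ℂ) (M : Matrix (Fin 4) (Fin 4) ℂ) : Prop :=
  Mᴴ * Dirac 0 * M = s • Dirac 0 ∧ Mᵀ * chargeForm * M = s • chargeForm

theorem ScalesForms.mul {s t : ℂ} {M N : Matrix (Fin 4) (Fin 4) ℂ}
    (hM : ScalesForms s M) (hN : ScalesForms t N) : ScalesForms (s * t) (M * N) := by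
  constructor
  · calc (M * N)ᴴ * Dirac 0 * (M * N) = Nᴴ * (Mᴴ * Dirac 0 * M) * N := by
          simp only [conjTranspose_mul, Matrix.mul_assoc]
      _ = _ := by rw [hM.1, Matrix.mul_smul, Matrix.smul_mul, hN.1, smul_smul]
  · calc (M * N)ᵀ * chargeForm * (M * N) = Nᵀ * (Mᵀ * chargeForm * M) * N := by
          simp only [transpose_mul, Matrix.mul_assoc]
      _ = _ := by rw [hM.2, Matrix.mul_smul, Matrix.smul_mul, hN.2, smul_smul]

theorem ScalesForms.of_mul_eq_one {s : ℂ} {M N : Matrix (Fin 4) (Fin 4) ℂ}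
    (hM : ScalesForms s M) (hs : s * s = 1) (h : M * N = 1) : ScalesForms s N := by
  constructor
  · have key : Dirac 0 = s • (Nᴴ * Dirac 0 * N) := by
      calc Dirac 0 = (M * N)ᴴ * Dirac 0 * (M * N) := by simp [h]
        _ = Nᴴ * (Mᴴ * Dirac 0 * M) * N := by
          simp only [conjTranspose_mul, Matrix.mul_assoc]
        _ = _ := by rw [hM.1, Matrix.mul_smul, Matrix.smul_mul]
    conv_rhs => rw [key, smul_smul, hs, one_smul]
  · have key : chargeForm = s • (Nᵀ * chargeForm * N) := by
      calc chargeForm = (M * N)ᵀ * chargeForm * (M * N) := by simp [h]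
        _ = Nᵀ * (Mᵀ * chargeForm * M) * N := by
          simp only [transpose_mul, Matrix.mul_assoc]
        _ = _ := by rw [hM.2, Matrix.mul_smul, Matrix.smul_mul]
    conv_rhs => rw [key, smul_smul, hs, one_smul]

theorem scalesForms_one : ScalesForms 1 1 := by
  simp [ScalesForms]

theorem scalesForms_hatM {A : Matrix (Fin 2) (Fin 2) ℂ} (hA : A.det = 1) :
    ScalesForms 1 (hatM A) := by
  have hdet : A 0 0 * A 1 1 - A 0 1 * A 1 0 = 1 := by rw [← det_fin_two, hA]
  have hconj := congrArg (starRingEnd ℂ) hdet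
  simp only [map_sub, map_mul, map_one] at hconj
  have hinv : A⁻¹ = !![A 1 1, -A 0 1; -A 1 0, A 0 0] := by
    rw [Matrix.inv_def, hA, adjugate_fin_two]; simp
  constructor <;> ext i j <;> fin_cases i <;> fin_cases j <;>
    simp [hatM, hinv, Dirac, chargeForm, mul_apply, Fin.sum_univ_four] <;> grind

theorem scalesForms_dirac_zero : ScalesForms 1 (Dirac 0) := by
  constructor <;> ext i j <;> fin_cases i <;> fin_cases j <;>
    simp [Dirac, chargeForm, mul_apply, Fin.sum_univ_four]

theorem dirac_one_mul_two_mul_three : Dirac 1 * Dirac 2 * Dirac 3 =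
    !![0, 0, -I, 0; 0, 0, 0, -I; I, 0, 0, 0; 0, I, 0, 0] := by
  ext i j; fin_cases i <;> fin_cases j <;>
    simp [Dirac, mul_apply, Fin.sum_univ_four]

theorem scalesForms_dirac_one_mul_two_mul_three :
    ScalesForms (-1) (Dirac 1 * Dirac 2 * Dirac 3) := by
  rw [dirac_one_mul_two_mul_three]
  constructor <;> ext i j <;> fin_cases i <;> fin_cases j <;>
    simp [Dirac, chargeForm, mul_apply, Fin.sum_univ_four]

theorem exists_scalesForms_of_mem_closure {g : Matrix.GeneralLinearGroup (Fin 4) ℂ}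
    (hg : g ∈ Subgroup.closure (genSet (Dirac 0) (Dirac 1 * Dirac 2 * Dirac 3))) :
    ∃ s : ℂ, (s = 1 ∨ s = -1) ∧ ScalesForms s g.val := by
  induction hg using Subgroup.closure_induction with
  | mem x hx =>
    rcases hx with ⟨A, hA, hx⟩ | hx | hx
    · exact ⟨1, .inl rfl, hx ▸ scalesForms_hatM hA⟩
    · exact ⟨1, .inl rfl, hx ▸ scalesForms_dirac_zero⟩
    · exact ⟨-1, .inr rfl, hx ▸ scalesForms_dirac_one_mul_two_mul_three⟩
  | one => exact ⟨1, .inl rfl, scalesForms_one⟩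
  | mul x y _ _ hx hy =>
    obtain ⟨s, hs, hx⟩ := hx
    obtain ⟨t, ht, hy⟩ := hy
    refine ⟨s * t, ?_, hx.mul hy⟩
    rcases hs with rfl | rfl <;> rcases ht with rfl | rfl <;> simp
  | inv x _ hx =>
    obtain ⟨s, hs, hx⟩ := hx
    refine ⟨s, hs, hx.of_mul_eq_one ?_ x.mul_inv⟩
    rcases hs with rfl | rfl <;> simp

theorem eq_smul_one_of_commute_dirac {M : Matrix (Fin 4) (Fin 4) ℂ}
    (h : ∀ m : Fin 4, M * Dirac m = Dirac m * M) : M = M 0 0 • 1 := by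
  have e (m i j : Fin 4) := congrFun (congrFun (h m) i) j
  simp only [mul_apply, Fin.sum_univ_four] at e
  have e0 := e 0
  have e1 := e 1
  have e2 := e 2
  have e3 := e 3
  simp only [Fin.forall_fin_succ, Dirac] at e0 e1 e2 e3
  simp at e0 e1 e2 e3
  have hI : I * I = -1 := I_mul_I
  ext i j
  fin_cases i <;> fin_cases j <;> simp <;> grind

/-- If Shat ∈ G commutes with all four Dirac matrices then Shat = ±1. -/
theorem stmt13 (Shat : Matrix.GeneralLinearGroup (Fin 4) ℂ)
    (hmem : Shat ∈ Subgroup.closure (genSet (Dirac 0) (Dirac 1 * Dirac 2 * Dirac 3)))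
    (hcomm : ∀ m : Fin 4, Shat.val * Dirac m = Dirac m * Shat.val) :
    Shat.val = 1 ∨ Shat.val = -1 := by
  obtain ⟨s, hs, hγ, hC⟩ := exists_scalesForms_of_mem_closure hmem
  have hM := eq_smul_one_of_commute_dirac hcomm
  generalize Shat.val 0 0 = c at hM
  rw [hM] at hγ hC ⊢
  have h1 := congrFun (congrFun hγ 0) 2
  have h2 := congrFun (congrFun hC 0) 1
  simp [Dirac, chargeForm] at h1 h2
  have hs1 : s = 1 := by
    refine hs.resolve_right fun hs => ?_
    rw [mul_conj, hs] at h1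
    have := congrArg re h1
    simp only [ofReal_re, neg_re, one_re] at this
    linarith [normSq_nonneg c]
  rw [hs1] at h2
  rcases mul_self_eq_one_iff.mp h2 with rfl | rfl <;> simp
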